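/- Every super-biderivation φ of homogeneous degree on the centerless super-Virasoro algebra S(0) is even, i.e. |φ| = 0̄, so that φ maps pairs of homogeneous elements of degrees α, β into the homogeneous component of degree α + β. -/

import Mathlib

/-- The underlying vector space of the centerless super-Virasoro algebra `S(0)`:
the first factor records the coefficients of the even basis `{L_m | m ∈ ℤ}` and the
second factor the coefficients of the odd basis `{G_k | k ∈ ℤ}`. -/
abbrev SVir0 : Type := (ℤ →₀ ℂ) × (ℤ →₀ ℂ)

/-- The even basis vector `L_m` of `S(0)`. -/
noncomputable def Lgen (m : ℤ) : SVir0 := (Finsupp.single m 1, 0)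

/-- The odd basis vector `G_k` of `S(0)`. -/
noncomputable def Ggen (k : ℤ) : SVir0 := (0, Finsupp.single k 1)

/-- The super bracket of `S(0)`, determined by `[L_m, L_n] = (n-m)L_{m+n}`,
`[L_m, G_k] = (k - m/2)G_{m+k}`, `[G_k, L_m] = -(k - m/2)G_{m+k}` and
`[G_k, G_l] = 2L_{k+l}`, extended bilinearly. -/
noncomputable def sbk (x y : SVir0) : SVir0 :=
  ( x.1.sum (fun m a => y.1.sum fun n b =>
      Finsupp.single (m + n) (a * b * ((n : ℂ) - (m : ℂ))))
    + x.2.sum (fun k a => y.2.sum fun l b =>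
      Finsupp.single (k + l) (2 * (a * b))),
    x.1.sum (fun m a => y.2.sum fun k b =>
      Finsupp.single (m + k) (a * b * ((k : ℂ) - (m : ℂ) / 2)))
    + x.2.sum (fun k a => y.1.sum fun m b =>
      Finsupp.single (m + k) (-(a * b * ((k : ℂ) - (m : ℂ) / 2)))) )

/-- The homogeneous components of `S(0)`: degree `0̄` is the even part (the span of
the `L_m`), degree `1̄` is the odd part (the span of the `G_k`). -/
def grad : ZMod 2 → Set SVir0 := fun i =>
  if i = 0 then {x | x.2 = 0} else {x | x.1 = 0}

/-- A super-biderivation of homogeneous degree `d` of `S(0)`: a bilinear map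
`φ : S(0) × S(0) → S(0)` with `φ(L_α, L_β) ⊆ L_{α+β+d}`, which is skew-supersymmetric,
`φ(x,y) = -(-1)^{|x||y|}φ(y,x)`, and satisfies
`φ([x,y],z) = (-1)^{d|x|}[x,φ(y,z)] + (-1)^{|y||z|}[φ(x,z),y]` and
`φ(x,[y,z]) = [φ(x,y),z] + (-1)^{(d+|x|)|y|}[y,φ(x,z)]` for homogeneous `x, y, z`. -/
def IsSuperBiderivationSV (d : ZMod 2) (φ : SVir0 →ₗ[ℂ] SVir0 →ₗ[ℂ] SVir0) : Prop :=
  (∀ (α β : ZMod 2) (x y : SVir0), x ∈ grad α → y ∈ grad β →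
      φ x y ∈ grad (α + β + d)) ∧
  (∀ (α β : ZMod 2) (x y : SVir0), x ∈ grad α → y ∈ grad β →
      φ x y = (-(-1 : ℂ) ^ (α * β).val) • φ y x) ∧
  (∀ (α β γ : ZMod 2) (x y z : SVir0), x ∈ grad α → y ∈ grad β → z ∈ grad γ →
      φ (sbk x y) z =
        ((-1 : ℂ) ^ (d * α).val) • sbk x (φ y z) +
          ((-1 : ℂ) ^ (β * γ).val) • sbk (φ x z) y) ∧
  (∀ (α β γ : ZMod 2) (x y z : SVir0), x ∈ grad α → y ∈ grad β → z ∈ grad γ →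
      φ x (sbk y z) =
        sbk (φ x y) z + ((-1 : ℂ) ^ ((d + α) * β).val) • sbk y (φ x z))

theorem sbk_zero_left (u : SVir0) : sbk 0 u = 0 := by
  simp [sbk]

theorem sbk_zero_right (u : SVir0) : sbk u 0 = 0 := by
  simp [sbk]

theorem sbk_Lgen_Lgen (m n : ℤ) :
    sbk (Lgen m) (Lgen n) = ((n : ℂ) - m) • Lgen (m + n) := by
  simp [sbk, Lgen, -Finsupp.single_sub, -Finsupp.single_mul]

theorem sbk_Lgen_Ggen (m k : ℤ) :
    sbk (Lgen m) (Ggen k) = ((k : ℂ) - m / 2) • Ggen (m + k) := by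
  simp [sbk, Lgen, Ggen, -Finsupp.single_sub, -Finsupp.single_mul]

theorem sbk_L0_fst (u : SVir0) (k : ℤ) : (sbk (Lgen 0) u).1 k = k * u.1 k := by
  simp only [sbk, Lgen]
  rw [Finsupp.sum_single_index (by simp)]
  simp [Finsupp.sum_apply, Finsupp.single_apply, Finsupp.sum, Finset.sum_ite_eq', mul_comm]
  intro h
  simp [h]

theorem sbk_L0_snd (u : SVir0) (k : ℤ) : (sbk (Lgen 0) u).2 k = k * u.2 k := by
  simp only [sbk, Lgen]
  rw [Finsupp.sum_single_index (by simp)]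
  simp [Finsupp.sum_apply, Finsupp.single_apply, Finsupp.sum, Finset.sum_ite_eq', mul_comm]
  intro h
  simp [h]

/-- The weight vectors of `ad L_0`. -/
theorem weight_eq (u : SVir0) (m : ℤ) (h : sbk (Lgen 0) u = (m : ℂ) • u) :
    u = (Finsupp.single m (u.1 m), Finsupp.single m (u.2 m)) := by
  have key : ∀ k : ℤ, k ≠ m → u.1 k = 0 ∧ u.2 k = 0 := by
    intro k hk
    have hk' : (k : ℂ) - m ≠ 0 := by
      rw [sub_ne_zero]; exact_mod_cast hk
    have h1 := sbk_L0_fst u k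
    have h2 := sbk_L0_snd u k
    rw [h] at h1 h2
    simp only [Prod.smul_fst, Prod.smul_snd, Finsupp.smul_apply, smul_eq_mul] at h1 h2
    constructor
    · apply (mul_eq_zero.1 (show ((k : ℂ) - m) * u.1 k = 0 by linear_combination -h1)).resolve_left hk'
    · apply (mul_eq_zero.1 (show ((k : ℂ) - m) * u.2 k = 0 by linear_combination -h2)).resolve_left hk'
  apply Prod.ext
  · ext k
    by_cases hk : k = m
    · subst hk; simp
    · simp [(key k hk).1, Finsupp.single_apply, Ne.symm hk]
  · ext k
    by_cases hk : k = m
    · subst hk; simp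
    · simp [(key k hk).2, Finsupp.single_apply, Ne.symm hk]

theorem Lgen_mem (m : ℤ) : Lgen m ∈ grad 0 := by simp [grad, Lgen]

theorem Ggen_mem (m : ℤ) : Ggen m ∈ grad 1 := by simp [grad, Ggen]

theorem zero_mem_grad (a : ZMod 2) : (0 : SVir0) ∈ grad a := by
  unfold grad; split_ifs <;> simp

theorem L0_Lgen (m : ℤ) : sbk (Lgen 0) (Lgen m) = (m : ℂ) • Lgen m := by
  rw [sbk_Lgen_Lgen]; simp

theorem L0_Ggen (m : ℤ) : sbk (Lgen 0) (Ggen m) = (m : ℂ) • Ggen m := by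
  rw [sbk_Lgen_Ggen]; simp

section
variable {φ : SVir0 →ₗ[ℂ] SVir0 →ₗ[ℂ] SVir0}

theorem phi_LL (hφ : IsSuperBiderivationSV 1 φ) (m : ℤ) : φ (Lgen m) (Lgen m) = 0 := by
  have h := hφ.2.1 0 0 _ _ (Lgen_mem m) (Lgen_mem m)
  simp at h
  exact self_eq_neg.1 (h.trans (neg_one_smul ℂ (φ (Lgen m) (Lgen m))))

/-- The second Leibniz rule with an even middle element. -/
theorem leib2 (hφ : IsSuperBiderivationSV 1 φ) (m : ℤ) {α γ : ZMod 2} {x z : SVir0}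
    (hx : x ∈ grad α) (hz : z ∈ grad γ) :
    φ x (sbk (Lgen m) z) = sbk (φ x (Lgen m)) z + sbk (Lgen m) (φ x z) := by
  have h := hφ.2.2.2 α 0 γ x (Lgen m) z hx (Lgen_mem m) hz
  simpa using h

theorem psi_weight (hφ : IsSuperBiderivationSV 1 φ) (n : ℤ) {γ : ZMod 2} {z : SVir0}
    (hz : z ∈ grad γ) (hw : sbk (Lgen 0) z = (n : ℂ) • z) :
    sbk (Lgen 0) (φ (Lgen 0) z) = (n : ℂ) • φ (Lgen 0) z := by
  have h := leib2 hφ 0 (Lgen_mem 0) hz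
  rw [phi_LL hφ, sbk_zero_left, zero_add, hw, map_smul] at h
  exact h.symm

theorem psi_L (hφ : IsSuperBiderivationSV 1 φ) (m : ℤ) : φ (Lgen 0) (Lgen m) = 0 := by
  by_cases hm : m = 0
  · subst hm; exact phi_LL hφ 0
  have hw := weight_eq _ m (psi_weight hφ m (Lgen_mem m) (L0_Lgen m))
  have hp := hφ.1 0 0 _ _ (Lgen_mem 0) (Lgen_mem m)
  simp only [grad, add_zero, zero_add, one_ne_zero, if_false, Set.mem_ofPred_eq] at hp
  have h := hφ.2.2.1 0 0 0 (Lgen 0) (Lgen m) (Lgen m) (Lgen_mem 0) (Lgen_mem m) (Lgen_mem m)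
  rw [L0_Lgen, map_smul, LinearMap.smul_apply, phi_LL hφ, sbk_zero_right] at h
  simp only [smul_zero, mul_zero, ZMod.val_zero, pow_zero, one_smul, zero_add] at h
  rw [hp] at hw
  have hw2 : φ (Lgen 0) (Lgen m) = ((0 : ℤ →₀ ℂ), Finsupp.single m ((φ (Lgen 0) (Lgen m)).2 m)) := by
    simpa using hw
  generalize (φ (Lgen 0) (Lgen m)).2 m = a at hw2
  rw [hw2] at h
  have h2 := congrArg (fun u : SVir0 => u.2 (m + m)) h
  simp [sbk, Lgen] at h2
  have hmC : (m : ℂ) ≠ 0 := by exact_mod_cast hm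
  have ha : a = 0 := by
    rcases h2 with h2 | h2
    · exact h2
    · exact absurd (by linear_combination 2 * h2) hmC
  rw [hw2, ha]; simp

theorem psi_G_even (hφ : IsSuperBiderivationSV 1 φ) (k : ℤ) (hk : k ≠ 0) :
    φ (Lgen 0) (Ggen (k + k)) = 0 := by
  have hw := weight_eq _ k (psi_weight hφ k (Ggen_mem k) (L0_Ggen k))
  have hp := hφ.1 0 1 _ _ (Lgen_mem 0) (Ggen_mem k)
  rw [show (0 + 1 + 1 : ZMod 2) = 0 from rfl] at hp
  simp only [grad, if_true, Set.mem_ofPred_eq] at hp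
  have h := leib2 hφ k (Lgen_mem 0) (Ggen_mem k)
  rw [psi_L hφ, sbk_zero_left, zero_add, sbk_Lgen_Ggen, map_smul] at h
  rw [hp] at hw
  generalize (φ (Lgen 0) (Ggen k)).1 k = b at hw
  rw [hw] at h
  have h3 : sbk (Lgen k) ((Finsupp.single k b, Finsupp.single k ((0 : ℤ →₀ ℂ) k)) : SVir0) = 0 := by
    simp [sbk, Lgen]
  rw [h3] at h
  refine (smul_eq_zero.1 h).resolve_left ?_
  have hkC : (k : ℂ) ≠ 0 := by exact_mod_cast hk
  intro h4
  exact hkC (by linear_combination 2 * h4)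

theorem psi_G (hφ : IsSuperBiderivationSV 1 φ) (t : ℤ) : φ (Lgen 0) (Ggen t) = 0 := by
  have main : ∀ k : ℤ, k ≠ 0 → 6 * k ≠ t → φ (Lgen 0) (Ggen t) = 0 := by
    intro k hk hkt
    have h := leib2 hφ (t - (k + k)) (Lgen_mem 0) (Ggen_mem (k + k))
    rw [psi_L hφ, sbk_zero_left, zero_add, psi_G_even hφ k hk, sbk_zero_right, sbk_Lgen_Ggen,
      map_smul, sub_add_cancel] at h
    refine (smul_eq_zero.1 h).resolve_left ?_
    push_cast
    intro h4
    apply hkt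
    have h5 : (6 * k : ℂ) = t := by linear_combination 2 * h4
    exact_mod_cast h5
  by_cases ht : t = 6
  · exact main 2 (by norm_num) (by omega)
  · exact main 1 (by norm_num) (by omega)

theorem phi_ne (hφ : IsSuperBiderivationSV 1 φ) {α γ : ZMod 2} {y z : SVir0} {m n : ℤ}
    (hmn : m ≠ n) (hy : y ∈ grad α) (hz : z ∈ grad γ)
    (hwy : sbk (Lgen 0) y = (m : ℂ) • y) (hwz : sbk (Lgen 0) z = (n : ℂ) • z)
    (py : φ (Lgen 0) y = 0) (pz : φ (Lgen 0) z = 0) : φ y z = 0 := by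
  have h1 := leib2 hφ 0 hy hz
  have py' : φ y (Lgen 0) = 0 := by
    rw [hφ.2.1 α 0 _ _ hy (Lgen_mem 0), py, smul_zero]
  rw [py', sbk_zero_left, zero_add, hwz, map_smul] at h1
  have h2 := hφ.2.2.1 0 α γ (Lgen 0) y z (Lgen_mem 0) hy hz
  rw [pz, sbk_zero_left, smul_zero, add_zero, hwy, map_smul, LinearMap.smul_apply, ← h1] at h2
  simp only [mul_zero, ZMod.val_zero, pow_zero, one_smul] at h2
  rw [← sub_eq_zero] at h2
  have h3 := (sub_smul (m : ℂ) (n : ℂ) (φ y z)).trans h2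
  refine (smul_eq_zero.1 h3).resolve_left ?_
  apply sub_ne_zero.2
  exact_mod_cast hmn

theorem phi_L (hφ : IsSuperBiderivationSV 1 φ) {α : ZMod 2} {y : SVir0} {m : ℤ} (n : ℤ)
    (hy : y ∈ grad α) (hwy : sbk (Lgen 0) y = (m : ℂ) • y) (py : φ (Lgen 0) y = 0) :
    φ y (Lgen n) = 0 := by
  have ne : ∀ k, m ≠ k → φ y (Lgen k) = 0 := fun k hk =>
    phi_ne hφ hk hy (Lgen_mem k) hwy (L0_Lgen k) py (psi_L hφ k)
  by_cases hmn : m = n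
  · subst hmn
    obtain ⟨j, hj0, hjm, hj2⟩ : ∃ j : ℤ, j ≠ 0 ∧ m ≠ j ∧ m ≠ 2 * j :=
      ⟨|m| + 1, by grind, by grind, by grind⟩
    have h := leib2 hφ j hy (Lgen_mem (m - j))
    rw [ne j hjm, ne (m - j) (by omega), sbk_zero_left, sbk_zero_right, sbk_Lgen_Lgen, map_smul,
      add_zero, add_sub_cancel] at h
    refine (smul_eq_zero.1 h).resolve_left ?_
    push_cast
    intro h4
    apply hj2
    have h5 : (m : ℂ) = 2 * j := by linear_combination h4
    exact_mod_cast h5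
  · exact ne n hmn

theorem phi_G (hφ : IsSuperBiderivationSV 1 φ) {α : ZMod 2} {y : SVir0} {m : ℤ} (n : ℤ)
    (hy : y ∈ grad α) (hwy : sbk (Lgen 0) y = (m : ℂ) • y) (py : φ (Lgen 0) y = 0) :
    φ y (Ggen n) = 0 := by
  have ne : ∀ k, m ≠ k → φ y (Ggen k) = 0 := fun k hk =>
    phi_ne hφ hk hy (Ggen_mem k) hwy (L0_Ggen k) py (psi_G hφ k)
  by_cases hmn : m = n
  · subst hmn
    obtain ⟨j, hj0, hj2⟩ : ∃ j : ℤ, j ≠ 0 ∧ 2 * m ≠ 3 * j :=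
      ⟨|m| + 1, by grind, by grind⟩
    have h := leib2 hφ j hy (Ggen_mem (m - j))
    rw [phi_L hφ j hy hwy py, ne (m - j) (by omega), sbk_zero_left, sbk_zero_right, sbk_Lgen_Ggen,
      map_smul, add_zero, add_sub_cancel] at h
    refine (smul_eq_zero.1 h).resolve_left ?_
    push_cast
    intro h4
    apply hj2
    have h5 : (2 * m : ℂ) = 3 * j := by linear_combination 2 * h4
    exact_mod_cast h5
  · exact ne n hmn

theorem lin_ext {M : Type*} [AddCommMonoid M] [Module ℂ M] (f g : SVir0 →ₗ[ℂ] M)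
    (hL : ∀ m, f (Lgen m) = g (Lgen m)) (hG : ∀ m, f (Ggen m) = g (Ggen m)) : f = g := by
  apply LinearMap.prod_ext
  · apply Finsupp.lhom_ext'
    intro m
    ext
    simpa [Lgen] using hL m
  · apply Finsupp.lhom_ext'
    intro m
    ext
    simpa [Ggen] using hG m

theorem phi_zero (hφ : IsSuperBiderivationSV 1 φ) : φ = 0 := by
  apply lin_ext
  · intro m
    apply lin_ext
    · intro n; simpa using phi_L hφ n (Lgen_mem m) (L0_Lgen m) (psi_L hφ m)
    · intro n; simpa using phi_G hφ n (Lgen_mem m) (L0_Lgen m) (psi_L hφ m)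
  · intro m
    apply lin_ext
    · intro n; simpa using phi_L hφ n (Ggen_mem m) (L0_Ggen m) (psi_G hφ m)
    · intro n; simpa using phi_G hφ n (Ggen_mem m) (L0_Ggen m) (psi_G hφ m)

end

/-- every super-biderivation of homogeneous degree on the centerless
super-Virasoro algebra `S(0)` is even: if `φ ≠ 0` then `|φ| = 0̄`, and `φ` maps pairs
of homogeneous elements of degrees `α, β` into the homogeneous component of degree
`α + β`. -/
theorem superBiderivation_SVir0_is_even (d : ZMod 2)
    (φ : SVir0 →ₗ[ℂ] SVir0 →ₗ[ℂ] SVir0) (hφ : IsSuperBiderivationSV d φ) :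
    (φ ≠ 0 → d = 0) ∧
      (∀ (α β : ZMod 2) (x y : SVir0), x ∈ grad α → y ∈ grad β →
        φ x y ∈ grad (α + β)) := by
  have hd : d = 0 ∨ d = 1 := by
    have hh : ∀ e : ZMod 2, e = 0 ∨ e = 1 := by decide
    exact hh d
  rcases hd with rfl | rfl
  · refine ⟨fun _ => rfl, fun α β x y hx hy => ?_⟩
    simpa using hφ.1 α β x y hx hy
  · have h0 := phi_zero hφ
    refine ⟨fun h => absurd h0 h, fun α β x y _ _ => ?_⟩
    rw [h0]
    exact zero_mem_grad _
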